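/- arXiv:0902.3093 — 2 statements merged into one kernel-verified Lean document; each statement's English description precedes it below -/
import Mathlib

section
/- Let A be an additive basis of order h, and let X be a finite nonempty subset of A such that A \ X is still an additive basis. Set η := min{|a−b| : a, b ∈ A \ X, a ≠ b, |a−b| ≥ diam(X)}. Then G(A \ X) ≤ η(h²−1) + h + 1. -/
open Pointwise

/-- The `h`-fold sumset of a set `S` of integers:
sums of `h` elements of `S` (with repetitions); `0`-fold sumset is `{0}`. -/
def foldSum (h : ℕ) (S : Set ℤ) : Set ℤ :=
  {z : ℤ | ∃ f : Fin h → ℤ, (∀ i, f i ∈ S) ∧ ∑ i, f i = z}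

/-- Every sufficiently large integer is a sum of `h` elements of `A`. -/
def RepBy (A : Set ℤ) (h : ℕ) : Prop :=
  ∀ᶠ N : ℤ in Filter.atTop, N ∈ foldSum h A

/-- `A ⊆ ℤ` is an additive basis: it has only finitely many negative elements and
there is `h ≥ 1` such that every sufficiently large positive integer is a
sum of `h` elements of `A`. -/
def IsAdditiveBasis (A : Set ℤ) : Prop :=
  {n : ℤ | n ∈ A ∧ n < 0}.Finite ∧ ∃ h : ℕ, 1 ≤ h ∧ RepBy A h

/-- The order `G(A)` of an additive basis: the least `h ≥ 1` such that every
sufficiently large positive integer is a sum of `h` elements of `A`. -/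
noncomputable def basisOrder (A : Set ℤ) : ℕ :=
  sInf {h : ℕ | 1 ≤ h ∧ RepBy A h}

/-- The diameter of a finite set of integers: `max {|x - y| : x, y ∈ X}` (as a natural number). -/
def diamN (X : Finset ℤ) : ℕ :=
  (X ×ˢ X).sup fun p => (p.1 - p.2).natAbs

/-- `δ(X) := gcd {x - y : x, y ∈ X}`, with the convention `δ(X) = 1` when `|X| = 1`. -/
def deltaN (X : Finset ℤ) : ℕ :=
  if 2 ≤ X.card then (X ×ˢ X).gcd (fun p => (p.1 - p.2).natAbs) else 1

theorem fs_zero (S : Set ℤ) : (0:ℤ) ∈ foldSum 0 S := ⟨fun _ => 0, fun i => i.elim0, by simp⟩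

theorem fs_one {S : Set ℤ} {x : ℤ} (hx : x ∈ S) : x ∈ foldSum 1 S :=
  ⟨fun _ => x, fun _ => hx, by simp⟩

theorem fs_add {S : Set ℤ} {m n : ℕ} {x y : ℤ} (hx : x ∈ foldSum m S) (hy : y ∈ foldSum n S) :
    x + y ∈ foldSum (m + n) S := by
  obtain ⟨f, hf, rfl⟩ := hx
  obtain ⟨g, hg, rfl⟩ := hy
  refine ⟨Fin.append f g, ?_, ?_⟩
  · intro i
    refine Fin.addCases (fun i => ?_) (fun i => ?_) i
    · simpa using hf i
    · simpa using hg i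
  · simp [Fin.sum_univ_add]

theorem fs_mul {S : Set ℤ} {x : ℤ} (hx : x ∈ S) (m : ℕ) : (m : ℤ) * x ∈ foldSum m S :=
  ⟨fun _ => x, fun _ => hx, by simp⟩

theorem fs_eq_zero {S : Set ℤ} {x : ℤ} (hx : x ∈ foldSum 0 S) : x = 0 := by
  obtain ⟨f, hf, rfl⟩ := hx
  simp

theorem fs_succ {S : Set ℤ} {m : ℕ} {x : ℤ} (hx : x ∈ foldSum (m + 1) S) :
    ∃ b ∈ S, ∃ y ∈ foldSum m S, x = b + y := by
  obtain ⟨f, hf, rfl⟩ := hx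
  exact ⟨f 0, hf 0, _, ⟨fun i => f i.succ, fun i => hf _, rfl⟩, Fin.sum_univ_succ f⟩

theorem fs_split {A : Set ℤ} {X : Set ℤ} (h : ℕ) : ∀ z ∈ foldSum h A,
    ∃ p k, p + k = h ∧ ∃ s ∈ foldSum p (A \ X), ∃ t ∈ foldSum k X, z = s + t := by
  induction h with
  | zero =>
    intro z hz
    exact ⟨0, 0, rfl, 0, fs_zero _, 0, fs_zero _, by rw [fs_eq_zero hz]; rfl⟩
  | succ n ih =>
    intro z hz
    obtain ⟨b, hb, y, hy, rfl⟩ := fs_succ hz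
    obtain ⟨p, k, hpk, s, hs, t, ht, rfl⟩ := ih y hy
    by_cases hbX : b ∈ X
    · exact ⟨p, k + 1, by omega, s, hs, t + b, fs_add ht (fs_one hbX), by ring⟩
    · exact ⟨p + 1, k, by omega, s + b, fs_add hs (fs_one ⟨hb, hbX⟩), t, ht, by ring⟩

theorem fs_bound {S : Set ℤ} {l u : ℤ} (hl : ∀ x ∈ S, l ≤ x) (hu : ∀ x ∈ S, x ≤ u) (k : ℕ) :
    ∀ t ∈ foldSum k S, k * l ≤ t ∧ t ≤ k * u := by
  rintro t ⟨f, hf, rfl⟩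
  constructor
  · simpa using Finset.card_nsmul_le_sum Finset.univ f l (fun i _ => hl _ (hf i))
  · simpa using Finset.sum_le_card_nsmul Finset.univ f u (fun i _ => hu _ (hf i))

theorem fs_upper {S : Set ℤ} {u : ℤ} (hu : ∀ x ∈ S, x ≤ u) (k : ℕ) :
    ∀ t ∈ foldSum k S, t ≤ k * u := by
  rintro t ⟨f, hf, rfl⟩
  simpa using Finset.sum_le_card_nsmul Finset.univ f u (fun i _ => hu _ (hf i))

/-- Propagation along differences of elements of `B`. -/
theorem chain_step {B : Set ℤ} {P : ℤ → Prop} {N0 : ℤ}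
    (hP : ∀ N N', N0 ≤ N → N0 ≤ N' → ∀ b ∈ B, ∀ b' ∈ B, N' + b' = N + b → P N → P N') (k : ℕ) :
    ∀ u ∈ foldSum k B, ∀ v ∈ foldSum k B, ∃ K : ℤ, ∀ N ≥ K, P N → P (N + u - v) := by
  induction k with
  | zero =>
    intro u hu v hv
    rw [fs_eq_zero hu, fs_eq_zero hv]
    exact ⟨0, fun N _ h => by simpa using h⟩
  | succ n ih =>
    intro u hu v hv
    obtain ⟨b, hb, u', hu', rfl⟩ := fs_succ hu
    obtain ⟨b', hb', v', hv', rfl⟩ := fs_succ hv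
    obtain ⟨K, hK⟩ := ih u' hu' v' hv'
    refine ⟨max K (max (N0 - u' + v') (N0 - u' + v' - b + b')), fun N hN h => ?_⟩
    have h1 := le_trans (le_max_left _ _) hN
    have h2 := le_trans ((le_max_left _ _).trans (le_max_right _ _)) hN
    have h3 := le_trans ((le_max_right _ _).trans (le_max_right _ _)) hN
    exact hP (N + u' - v') _ (by linarith) (by linarith) b hb b' hb' (by ring) (hK N h1 h)

/-- Covering lemma. -/
theorem cover_lemma {B : Set ℤ} {h k : ℕ} (hk : RepBy B k) (T : Finset ℤ) (N0 : ℤ)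
    (hT : ∀ N ≥ N0, ∃ c ∈ T, N - c ∈ foldSum h B) :
    ∃ j, j + 1 ≤ T.card ∧ RepBy B (h + j * (h + 1)) := by
  classical
  obtain ⟨M, hM⟩ := Filter.eventually_atTop.1 hk
  -- good subsets
  let good : Finset ℤ → Prop := fun S =>
    ∃ j, S.card = j + 1 ∧ ∃ c, ∀ s ∈ S, s - c ∈ foldSum (j * (h + 1)) B
  have key : ∀ c0 ∈ T, ∃ S ⊆ T, c0 ∈ S ∧ good S ∧ ∀ c ∈ S, ∀ c' ∈ T,
      (∃ u ∈ foldSum (h+1) B, ∃ v ∈ foldSum (h+1) B, c + u = c' + v) → c' ∈ S := by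
    intro c0 hc0
    obtain ⟨S, hS, hmax⟩ := Finset.exists_max_image
      (T.powerset.filter (fun S => c0 ∈ S ∧ good S)) Finset.card
      ⟨{c0}, by
        simp only [Finset.mem_filter, Finset.mem_powerset, Finset.singleton_subset_iff]
        refine ⟨hc0, by simp, 0, by simp, c0, fun s hs => ?_⟩
        rw [Finset.mem_singleton.1 hs]
        simpa using fs_zero B⟩
    simp only [Finset.mem_filter, Finset.mem_powerset] at hS hmax
    obtain ⟨hST, hcS, hg⟩ := hS
    refine ⟨S, hST, hcS, hg, ?_⟩
    rintro c hc c' hc' ⟨u, hu, v, hv, huv⟩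
    by_contra hn
    obtain ⟨j, hj, d, hd⟩ := hg
    have := hmax (insert c' S) ⟨Finset.insert_subset hc' hST, by simp [hcS], j + 1,
      by rw [Finset.card_insert_of_notMem hn, hj], d - v, ?_⟩
    · rw [Finset.card_insert_of_notMem hn] at this
      omega
    · intro s hs
      rw [show (j + 1) * (h + 1) = j * (h + 1) + (h + 1) by ring]
      rcases Finset.mem_insert.1 hs with rfl | hs
      · have := fs_add (hd c hc) hu
        convert this using 1
        linarith
      · have := fs_add (hd s hs) hv
        convert this using 1
        ring
  -- the propagation
  have prop : ∀ c0 ∈ T, ∀ S ⊆ T, (∀ c ∈ S, ∀ c' ∈ T,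
      (∃ u ∈ foldSum (h+1) B, ∃ v ∈ foldSum (h+1) B, c + u = c' + v) → c' ∈ S) →
      ∃ K : ℤ, ∀ N ≥ K, (∃ c ∈ S, N - c ∈ foldSum h B) → ∃ c ∈ S, N + 1 - c ∈ foldSum h B := by
    intro c0 _ S hS hcl
    obtain ⟨K, hK⟩ := chain_step (B := B) (P := fun N => ∃ c ∈ S, N - c ∈ foldSum h B) (N0 := N0)
      (by
        rintro N N' hN hN' b hb b' hb' e ⟨c, hc, hNc⟩
        obtain ⟨c', hc', hNc'⟩ := hT N' hN'
        exact ⟨c', hcl c hc c' hc' ⟨_, fs_add hNc (fs_one hb), _, fs_add hNc' (fs_one hb'),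
          by linarith⟩, hNc'⟩) k (M + 1) (hM _ (by linarith)) M (hM _ le_rfl)
    refine ⟨K, fun N hN hp => ?_⟩
    have := hK N hN hp
    rwa [show N + (M + 1) - M = N + 1 by ring] at this
  -- a uniform threshold over all subsets
  have unif : ∃ K : ℤ, ∀ S ∈ T.powerset, (∀ c ∈ S, ∀ c' ∈ T,
      (∃ u ∈ foldSum (h+1) B, ∃ v ∈ foldSum (h+1) B, c + u = c' + v) → c' ∈ S) →
      ∀ N ≥ K, (∃ c ∈ S, N - c ∈ foldSum h B) → ∃ c ∈ S, N + 1 - c ∈ foldSum h B := by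
    obtain ⟨c0, hc0, -⟩ := hT N0 le_rfl
    have : ∀ S : Finset ℤ, ∃ K : ℤ, S ∈ T.powerset → (∀ c ∈ S, ∀ c' ∈ T,
      (∃ u ∈ foldSum (h+1) B, ∃ v ∈ foldSum (h+1) B, c + u = c' + v) → c' ∈ S) →
      ∀ N ≥ K, (∃ c ∈ S, N - c ∈ foldSum h B) → ∃ c ∈ S, N + 1 - c ∈ foldSum h B := by
      intro S
      by_cases hS : S ∈ T.powerset ∧ (∀ c ∈ S, ∀ c' ∈ T,
        (∃ u ∈ foldSum (h+1) B, ∃ v ∈ foldSum (h+1) B, c + u = c' + v) → c' ∈ S)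
      · obtain ⟨K, hK⟩ := prop c0 hc0 S (Finset.mem_powerset.1 hS.1) hS.2
        exact ⟨K, fun _ _ => hK⟩
      · exact ⟨0, fun h1 h2 => (hS ⟨h1, h2⟩).elim⟩
    choose K hK using this
    obtain ⟨K', hK'⟩ := (T.powerset.image K).bddAbove
    refine ⟨K', fun S hS hcl N hN => hK S hS hcl N (le_trans (hK' ?_) hN)⟩
    exact Finset.mem_coe.2 (Finset.mem_image_of_mem K hS)
  obtain ⟨K, hK⟩ := unif
  obtain ⟨c0, hc0, hN1⟩ := hT (max N0 K) (le_max_left _ _)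
  obtain ⟨S, hST, hcS, ⟨j, hj, d, hd⟩, hcl⟩ := key c0 hc0
  refine ⟨j, hj ▸ Finset.card_le_card hST, ?_⟩
  have all : ∀ N ≥ max N0 K, ∃ c ∈ S, N - c ∈ foldSum h B := by
    intro N hN
    induction N, hN using Int.le_induction with
    | base => exact ⟨c0, hcS, hN1⟩
    | succ n hn ih =>
      exact hK S (Finset.mem_powerset.2 hST) hcl n (le_trans (le_max_right _ _) hn) ih
  refine Filter.eventually_atTop.2 ⟨max N0 K - d, fun N hN => ?_⟩
  obtain ⟨c, hc, hNc⟩ := all (N + d) (by linarith)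
  have := fs_add hNc (hd c hc)
  rwa [show N + d - c + (c - d) = N by ring] at this

theorem order_of_basis_minus_subset_le_of_eta
    (A : Set ℤ) (h : ℕ) (hA : IsAdditiveBasis A) (hordA : basisOrder A = h)
    (X : Finset ℤ) (hXne : X.Nonempty) (hXA : ↑X ⊆ A)
    (hB : IsAdditiveBasis (A \ ↑X))
    (η : ℕ)
    (hη : η = sInf {e : ℕ | ∃ a ∈ A \ ↑X, ∃ b ∈ A \ ↑X,
        a ≠ b ∧ (a - b).natAbs = e ∧ diamN X ≤ e}) :
    basisOrder (A \ ↑X) ≤ η * (h ^ 2 - 1) + h + 1 := by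
  classical
  obtain ⟨-, hA⟩ := hA
  have hmem := Nat.sInf_mem (s := {h : ℕ | 1 ≤ h ∧ RepBy A h}) hA
  change basisOrder A ∈ _ at hmem
  rw [hordA] at hmem
  obtain ⟨h1, hrep⟩ := hmem
  obtain ⟨-, k, hk1, hk⟩ := hB
  set B := A \ (X : Set ℤ) with hBdef
  -- B is unbounded above
  have hunb : ∀ u : ℤ, ∃ x ∈ B, u < x := by
    intro u
    by_contra! hcon
    obtain ⟨M, hM⟩ := Filter.eventually_atTop.1 hk
    have := fs_upper hcon k _ (hM (max M (k * u + 1)) (le_max_left _ _))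
    have := le_max_right M (k * u + 1)
    omega
  have hne : {e : ℕ | ∃ a ∈ B, ∃ b ∈ B,
        a ≠ b ∧ (a - b).natAbs = e ∧ diamN X ≤ e}.Nonempty := by
    obtain ⟨a, ha, -⟩ := hunb 0
    obtain ⟨b, hb, hab⟩ := hunb (a + diamN X)
    exact ⟨_, a, ha, b, hb, by omega, rfl, by omega⟩
  have hmem := Nat.sInf_mem hne
  rw [← hη] at hmem
  have hab : ∃ a ∈ B, ∃ b ∈ B, b = a + η ∧ 1 ≤ η ∧ diamN X ≤ η := by
    obtain ⟨a, ha, b, hb, hne, he, hd⟩ := hmem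
    rcases lt_or_gt_of_ne hne with hlt | hlt
    · exact ⟨a, ha, b, hb, by omega, by omega, hd⟩
    · exact ⟨b, hb, a, ha, by omega, by omega, hd⟩
  obtain ⟨a, ha, b, hb, hbη, hη1, hd⟩ := hab
  let x0 := X.min' hXne
  have hXl : ∀ x ∈ (X : Set ℤ), x0 ≤ x := fun x hx => X.min'_le x hx
  have hXu : ∀ x ∈ (X : Set ℤ), x ≤ x0 + η := by
    intro x hx
    have h2 : (x - x0).natAbs ≤ diamN X :=
      Finset.le_sup (f := fun p : ℤ × ℤ => (p.1 - p.2).natAbs) (b := (x, x0))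
        (Finset.mem_product.2 ⟨hx, X.min'_mem hXne⟩)
    omega
  let T : Finset ℤ := insert 0 (((Finset.range (h - 1)) ×ˢ (Finset.range η)).image
    (fun p => ((p.1 : ℤ) + 1) * (x0 - a) + p.2))
  have hTcard : T.card ≤ (h - 1) * η + 1 := by
    refine (Finset.card_insert_le _ _).trans ?_
    have := Finset.card_image_le (s := (Finset.range (h - 1)) ×ˢ (Finset.range η))
      (f := fun p => ((p.1 : ℤ) + 1) * (x0 - a) + p.2)
    rw [Finset.card_product, Finset.card_range, Finset.card_range] at this
    omega
  obtain ⟨M, hM⟩ := Filter.eventually_atTop.1 hrep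
  obtain ⟨j, hj, hj2⟩ := cover_lemma (h := h) hk T (max M (h * (x0 + η) + 1)) (by
    intro N hN
    obtain ⟨p, q, hpq, s, hs, t, ht, rfl⟩ :=
      fs_split (X := (X : Set ℤ)) h N (hM N ((le_max_left _ _).trans hN))
    have hN2 := (le_max_right _ _).trans hN
    obtain ⟨htl, htu⟩ := fs_bound hXl hXu q t ht
    rcases Nat.eq_zero_or_pos p with rfl | hp
    · exfalso
      have : q = h := by omega
      subst this
      have := fs_eq_zero hs
      omega
    rcases Nat.eq_zero_or_pos q with rfl | hq
    · refine ⟨0, by simp [T], ?_⟩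
      have := fs_eq_zero ht
      have : p = h := by omega
      subst this
      simpa [fs_eq_zero ht] using hs
    · -- main case
      have hη0 : (0 : ℤ) < η := by exact_mod_cast hη1
      set w := t - q * x0 with hw
      have hw0 : 0 ≤ w := by linarith
      have hwu : w ≤ q * η := by linarith
      have hdm := Int.emod_add_mul_ediv w η
      have hr0 := Int.emod_nonneg w hη0.ne'
      have hr1 := Int.emod_lt_of_pos w hη0
      have he0 := Int.ediv_nonneg hw0 hη0.le
      have he1 : w / η ≤ q := Int.ediv_le_of_le_mul hη0 hwu
      obtain ⟨r, hr⟩ := Int.eq_ofNat_of_zero_le hr0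
      obtain ⟨e, he⟩ := Int.eq_ofNat_of_zero_le he0
      rw [hr] at hr1 hdm
      rw [he] at he1 hdm
      refine ⟨((q - 1 : ℕ) + 1 : ℤ) * (x0 - a) + r, ?_, ?_⟩
      · refine Finset.mem_insert_of_mem (Finset.mem_image.2 ⟨(q - 1, r), ?_, rfl⟩)
        simp only [Finset.mem_product, Finset.mem_range]
        omega
      · have heq : e ≤ q := by exact_mod_cast he1
        have := fs_add hs (fs_add (fs_mul hb e) (fs_mul ha (q - e)))
        rw [show p + (e + (q - e)) = h by omega] at this
        convert this using 1
        push_cast [heq, Nat.cast_sub hq]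
        rw [hbη]
        linear_combination -hdm)
  have hle : h + j * (h + 1) ≤ η * (h ^ 2 - 1) + h + 1 := by
    have hj3 : j ≤ (h - 1) * η := by omega
    have := Nat.mul_le_mul_right (h + 1) hj3
    obtain ⟨g, rfl⟩ : ∃ g, h = g + 1 := ⟨h - 1, by omega⟩
    have e1 : (g + 1) ^ 2 - 1 = g * (g + 2) := by
      rw [show (g + 1) ^ 2 = g * (g + 2) + 1 by ring]; rfl
    rw [e1]
    simp only [Nat.add_sub_cancel] at this
    nlinarith
  exact (Nat.sInf_le (s := {h : ℕ | 1 ≤ h ∧ RepBy B h}) ⟨by omega, hj2⟩).trans hle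
end

section
/- Let A be an additive basis of order h, and let X be a finite nonempty subset of A such that A \ X is still an additive basis. Set μ := min_{y ∈ A \ X} diam(X ∪ {y}). Then G(A \ X) ≤ hμ(hμ+3)/2. -/
open Pointwise

section FiniteGroup

variable {G : Type*} [AddCommGroup G] [Fintype G] [DecidableEq G]

/-- Dyson transform argument: `|A + B + F| ≥ min (|G|, |A| + |B|)`. -/
lemma pair_card (F : Finset G) (hF0 : (0 : G) ∈ F) (hF : AddSubgroup.closure (F : Set G) = ⊤) :
    ∀ (n : ℕ) (A B : Finset G), A.Nonempty → B.Nonempty → B.card = n →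
      min (Fintype.card G) (A.card + B.card) ≤ (A + B + F).card := by
  intro n
  induction n using Nat.strong_induction_on with
  | _ n ih =>
    intro A B hA hB hn
    by_cases hst : ∃ e : G, (∃ b ∈ B, b + e ∈ A) ∧ ∃ b ∈ B, b + e ∉ A
    · obtain ⟨e, ⟨b, hb, hbA⟩, b', hb', hb'A⟩ := hst
      set A' := A ∪ B.image (fun x => x + e) with hA'
      set B' := B.filter (fun x => x + e ∈ A) with hB'
      have hlt : B'.card < n := by
        rw [← hn]
        apply Finset.card_lt_card
        refine ⟨Finset.filter_subset _ _, fun h => ?_⟩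
        have := h hb'
        simp [hB'] at this
        exact hb'A this.2
      have h1 := ih B'.card hlt A' B' (hA.mono Finset.subset_union_left)
        ⟨b, by simp [hB', hb, hbA]⟩ rfl
      have hcard : A'.card + B'.card = A.card + B.card := by
        have h2 := Finset.card_union_add_card_inter A (B.image (fun x => x + e))
        have h3 : (B.image (fun x => x + e)).card = B.card :=
          Finset.card_image_of_injective _ (add_left_injective e)
        have h4 : A ∩ B.image (fun x => x + e) = B'.image (fun x => x + e) := by
          ext x
          simp only [hB', Finset.mem_inter, Finset.mem_image, Finset.mem_filter]
          constructor
          · rintro ⟨hx, y, hy, rfl⟩; exact ⟨y, ⟨hy, hx⟩, rfl⟩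
          · rintro ⟨y, ⟨hy, hx⟩, rfl⟩; exact ⟨hx, y, hy, rfl⟩
        have h5 : (B'.image (fun x => x + e)).card = B'.card :=
          Finset.card_image_of_injective _ (add_left_injective e)
        rw [h4, h5, h3] at h2
        exact h2
      rw [hcard] at h1
      refine h1.trans (Finset.card_le_card (Finset.add_subset_add_right ?_))
      intro x hx
      obtain ⟨u, hu, v, hv, rfl⟩ := Finset.mem_add.1 hx
      simp only [hB', Finset.mem_filter] at hv
      simp only [hA', Finset.mem_union, Finset.mem_image] at hu
      rcases hu with hu | ⟨w, hw, rfl⟩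
      · exact Finset.add_mem_add hu hv.1
      · have : w + e + v = (v + e) + w := by abel
        rw [this]
        exact Finset.add_mem_add hv.2 hw
    · push Not at hst
      have key : ∀ a ∈ A, ∀ b ∈ B, ∀ b' ∈ B, a - b + b' ∈ A := by
        intro a ha b hb b' hb'
        have := hst (a - b) ⟨b, hb, by simpa using ha⟩ b' hb'
        rwa [add_comm] at this
      obtain ⟨b, hb⟩ := hB
      by_cases hst2 : ∀ a ∈ A, ∀ f ∈ F, a + f ∈ A
      · have hall : ∀ a ∈ A, ∀ x : G, a + x ∈ A := by
          intro a ha x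
          have hx : x ∈ AddSubgroup.closure (F : Set G) := by rw [hF]; trivial
          have hneg : ∀ f ∈ F, ∀ a ∈ A, a + -f ∈ A := by
            intro f hf a ha
            have himg : A.image (fun x => x + f) = A := by
              apply Finset.eq_of_subset_of_card_le
              · intro y hy
                obtain ⟨z, hz, rfl⟩ := Finset.mem_image.1 hy
                exact hst2 z hz f hf
              · rw [Finset.card_image_of_injective _ (add_left_injective f)]
            rw [← himg] at ha
            obtain ⟨z, hz, rfl⟩ := Finset.mem_image.1 ha
            simpa using hz
          have : ∀ a ∈ A, a + x ∈ A ∧ a + -x ∈ A := by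
            induction hx using AddSubgroup.closure_induction with
            | mem f hf => exact fun a ha => ⟨hst2 a ha f hf, hneg f hf a ha⟩
            | zero => intro a ha; simpa using ha
            | add y z _ _ hy hz =>
              intro a ha
              constructor
              · rw [← add_assoc]; exact (hz _ (hy _ ha).1).1
              · rw [neg_add, ← add_assoc]; exact (hz _ (hy _ ha).2).2
            | neg y _ hy =>
              intro a ha
              rw [neg_neg]
              exact ⟨(hy a ha).2, (hy a ha).1⟩
          exact (this a ha).1
        obtain ⟨a, ha⟩ := hA
        have huniv : A + B + F = Finset.univ := by
          ext x
          simp only [Finset.mem_univ, iff_true]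
          have h1 : a + (x - a - b) ∈ A := hall a ha _
          have h2 := Finset.add_mem_add (Finset.add_mem_add h1 hb) hF0
          have h3 : a + (x - a - b) + b + 0 = x := by abel
          rwa [h3] at h2
        rw [huniv, Finset.card_univ]
        exact min_le_left _ _
      · push Not at hst2
        obtain ⟨a, ha, f, hf, haf⟩ := hst2
        refine (min_le_right _ _).trans ?_
        have hdisj : Disjoint A (B.image (fun x => (a + f - b) + x)) := by
          rw [Finset.disjoint_left]
          intro x hx hx'
          obtain ⟨y, hy, rfl⟩ := Finset.mem_image.1 hx'
          have := key _ hx y hy b hb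
          apply haf
          have h3 : a + f - b + y - y + b = a + f := by abel
          rwa [h3] at this
        have h3 : (B.image (fun x => (a + f - b) + x)).card = B.card :=
          Finset.card_image_of_injective _ (add_right_injective _)
        rw [← h3, ← Finset.card_union_of_disjoint hdisj]
        have hsub : A ∪ B.image (fun x => (a + f - b) + x) ⊆ A + F := by
          intro x hx
          rcases Finset.mem_union.1 hx with hx | hx
          · simpa using Finset.add_mem_add hx hF0
          · obtain ⟨y, hy, rfl⟩ := Finset.mem_image.1 hx
            have := Finset.add_mem_add (key a ha b hb y hy) hf
            have h3 : a - b + y + f = a + f - b + y := by abel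
            rwa [h3] at this
        refine (Finset.card_le_card hsub).trans ?_
        have : (A + F).card = ((A + F).image (fun x => x + b)).card :=
          (Finset.card_image_of_injective _ (add_left_injective b)).symm
        rw [this]
        apply Finset.card_le_card
        intro x hx
        obtain ⟨y, hy, rfl⟩ := Finset.mem_image.1 hx
        obtain ⟨u, hu, v, hv, rfl⟩ := Finset.mem_add.1 hy
        have h3 : u + v + b = u + b + v := by abel
        simp only [h3]
        exact Finset.add_mem_add (Finset.add_mem_add hu hb) hv

lemma tuple_card (F : Finset G) (hF0 : (0 : G) ∈ F)
    (hF : AddSubgroup.closure (F : Set G) = ⊤) :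
    ∀ (n : ℕ) (A : Fin (n + 1) → Finset G), (∀ i, (A i).Nonempty) →
      ∃ D : Finset G, min (Fintype.card G) (∑ i, (A i).card) ≤ D.card ∧ D.Nonempty ∧
        ∀ d ∈ D, ∃ a : Fin (n + 1) → G, ∃ f : Fin n → G, (∀ i, a i ∈ A i) ∧ (∀ i, f i ∈ F) ∧
          d = ∑ i, a i + ∑ i, f i := by
  intro n
  induction n with
  | zero =>
    intro A hA
    refine ⟨A 0, by simp, hA 0, fun d hd => ⟨fun _ => d, fun _ => 0, ?_, ?_, ?_⟩⟩
    · intro i; rw [Fin.fin_one_eq_zero i]; exact hd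
    · intro i; exact i.elim0
    · simp
  | succ n ih =>
    intro A hA
    obtain ⟨D, hD, hDne, hDm⟩ := ih (fun i => A i.succ) (fun i => hA _)
    refine ⟨A 0 + D + F, ?_, ((hA 0).add hDne).add ⟨0, hF0⟩, ?_⟩
    · have h1 := pair_card F hF0 hF D.card (A 0) D (hA 0) hDne rfl
      rw [Fin.sum_univ_succ]
      omega
    · intro d hd
      obtain ⟨u, hu, v, hv, rfl⟩ := Finset.mem_add.1 hd
      obtain ⟨s, hs, t, ht, rfl⟩ := Finset.mem_add.1 hu
      obtain ⟨a, f, ha, hf, rfl⟩ := hDm t ht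
      refine ⟨Fin.cons s a, Fin.cons v f, ?_, ?_, ?_⟩
      · intro i; refine Fin.cases ?_ (fun j => ?_) i
        · simpa using hs
        · simpa using ha j
      · intro i; refine Fin.cases ?_ (fun j => ?_) i
        · simpa using hv
        · simpa using hf j
      · rw [Fin.sum_cons, Fin.sum_cons]
        abel

lemma tuple_full (F : Finset G) (hF0 : (0 : G) ∈ F)
    (hF : AddSubgroup.closure (F : Set G) = ⊤)
    (n : ℕ) (A : Fin (n + 1) → Finset G) (hA : ∀ i, (A i).Nonempty)
    (hc : Fintype.card G ≤ ∑ i, (A i).card) (d : G) :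
    ∃ a : Fin (n + 1) → G, ∃ f : Fin n → G, (∀ i, a i ∈ A i) ∧ (∀ i, f i ∈ F) ∧
          d = ∑ i, a i + ∑ i, f i := by
  obtain ⟨D, hD, -, hDm⟩ := tuple_card F hF0 hF n A hA
  rw [min_eq_left hc] at hD
  have : D = Finset.univ := Finset.eq_univ_of_card _ (le_antisymm (Finset.card_le_univ _) hD)
  exact hDm d (by rw [this]; exact Finset.mem_univ _)

end FiniteGroup

section Tuples

open Classical in
/-- Number of elements of `S` in `[x, x + m)`. -/
noncomputable def cnt (S : Set ℤ) (x : ℤ) (m : ℕ) : ℕ :=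
  ((Finset.range m).filter fun j : ℕ => x + (j : ℤ) ∈ S).card

/-- The tuple `A` has nonempty entries and its sumset is, up to translation, inside `C`. -/
def Tup (C : Set ℤ) {r : ℕ} (A : Fin r → Set ℤ) : Prop :=
  (∀ i, (A i).Nonempty) ∧
    ∃ z : ℤ, ∀ a : Fin r → ℤ, (∀ i, a i ∈ A i) → z + ∑ i, a i ∈ C

/-- There are `r`-tuples with total density arbitrarily close to one on long intervals. -/
def Good (C : Set ℤ) (r : ℕ) : Prop :=
  ∀ N w : ℕ, ∃ A : Fin r → Set ℤ, Tup C A ∧ ∃ (x : ℤ) (m : ℕ), w ≤ m ∧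
    N * m ≤ N * ∑ i, cnt (A i) x m + m

lemma cnt_le (S : Set ℤ) (x : ℤ) (m : ℕ) : cnt S x m ≤ m := by
  classical
  exact (Finset.card_filter_le _ _).trans (by simp)

lemma Tup.drop {C : Set ℤ} {n : ℕ} {A : Fin (n + 1) → Set ℤ} (h : Tup C A) (i : Fin (n + 1)) :
    Tup C (fun j => A (i.succAbove j)) := by
  obtain ⟨hne, z, hz⟩ := h
  refine ⟨fun j => hne _, ?_⟩
  obtain ⟨b, hb⟩ := hne i
  refine ⟨z + b, fun a ha => ?_⟩
  have := hz (i.insertNth b a) (by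
    intro j
    refine Fin.succAboveCases i ?_ (fun k => ?_) j
    · simpa using hb
    · simpa using ha k)
  rw [Fin.sum_univ_succAbove _ i] at this
  simp only [Fin.insertNth_apply_same, Fin.insertNth_apply_succAbove] at this
  rwa [add_assoc]

/-- The Dyson transform of a tuple in the first two entries. -/
def dys {n : ℕ} (A : Fin (n + 2) → Set ℤ) (e : ℤ) : Fin (n + 2) → Set ℤ :=
  Fin.cons {v | v ∈ A 0 ∨ v - e ∈ A 1}
    (Fin.cons {v | v ∈ A 1 ∧ v + e ∈ A 0} (fun i => A i.succ.succ))

lemma Tup.dys {C : Set ℤ} {n : ℕ} {A : Fin (n + 2) → Set ℤ} (h : Tup C A) (e : ℤ)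
    (he : ∃ y ∈ A 1, y + e ∈ A 0) : Tup C (dys A e) := by
  obtain ⟨hne, z, hz⟩ := h
  refine ⟨?_, z, ?_⟩
  · intro i
    refine Fin.cases ?_ (fun j => Fin.cases ?_ (fun k => ?_) j) i
    · obtain ⟨y, hy⟩ := hne 0
      exact ⟨y, Or.inl hy⟩
    · obtain ⟨y, hy, hy'⟩ := he
      exact ⟨y, hy, hy'⟩
    · exact hne _
  · intro a ha
    have h0 : a 0 ∈ A 0 ∨ a 0 - e ∈ A 1 := ha 0
    have h1 : a 1 ∈ A 1 ∧ a 1 + e ∈ A 0 := ha 1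
    have h2 : ∀ i : Fin n, a i.succ.succ ∈ A i.succ.succ := fun i => ha i.succ.succ
    rcases h0 with h0 | h0
    · apply hz
      intro i
      refine Fin.cases h0 (fun j => Fin.cases h1.1 (fun k => h2 k) j) i
    · have := hz (Fin.cons (a 1 + e) (Fin.cons (a 0 - e) (fun i => a i.succ.succ))) (by
        intro i
        refine Fin.cases h1.2 (fun j => Fin.cases h0 (fun k => h2 k) j) i)
      rw [Fin.sum_cons, Fin.sum_cons] at this
      rw [Fin.sum_univ_succ, Fin.sum_univ_succ]
      have h3 : a 1 + e + (a 0 - e + ∑ i : Fin n, a i.succ.succ)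
        = a 0 + (a (Fin.succ 0) + ∑ i : Fin n, a i.succ.succ) := by
        rw [Fin.succ_zero_eq_one]; ring
      rwa [h3] at this

open Classical in
lemma dys_cnt {n : ℕ} (A : Fin (n + 2) → Set ℤ) (e : ℤ) (x : ℤ) (m E : ℕ) (he : |e| ≤ E) :
    cnt (dys A e 0) x m = cnt (A 0) x m +
      ((Finset.range m).filter fun j : ℕ => x + j - e ∈ A 1 ∧ x + j ∉ A 0).card ∧
    ∑ i, cnt (A i) x m ≤ ∑ i, cnt (dys A e i) x m + E := by
  have h0 : cnt (dys A e 0) x m = cnt (A 0) x m +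
      ((Finset.range m).filter fun j : ℕ => x + j - e ∈ A 1 ∧ x + j ∉ A 0).card := by
    unfold cnt
    rw [← Finset.card_union_of_disjoint]
    · congr 1
      ext j
      simp only [Finset.mem_filter, Finset.mem_union]
      change (_ ∧ (_ ∨ _)) ↔ _
      tauto
    · rw [Finset.disjoint_left]
      intro j hj hj'
      simp only [Finset.mem_filter] at hj hj'
      tauto
  refine ⟨h0, ?_⟩
  have h1 : cnt (A 1) x m ≤ cnt (dys A e 1) x m +
      ((Finset.range m).filter fun j : ℕ => x + j - e ∈ A 1 ∧ x + j ∉ A 0).card + E := by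
    unfold cnt
    set U := (Finset.range m).filter fun j : ℕ => x + j - e ∈ A 1 ∧ x + j ∉ A 0
    set V := (Finset.range m).filter fun j : ℕ => x + (j : ℤ) ∈ dys A e 1
    have hd : (((Finset.range m).filter fun j : ℕ => x + (j : ℤ) ∈ A 1) \ V).card
        ≤ U.card + E := by
      have hEc : (Finset.Ico (-(E : ℤ)) 0 ∪ Finset.Ico (m : ℤ) (m + E)).card ≤ 2 * E := by
        refine (Finset.card_union_le _ _).trans ?_
        simp only [Int.card_Ico]
        omega
      -- shift by e
      have hinj : Function.Injective (fun j : ℕ => (j : ℤ) + e) := by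
        intro a b hab; simpa using hab
      rw [← Finset.card_image_of_injective _ hinj]
      have hU : U.card = (U.image (fun j : ℕ => (j : ℤ))).card :=
        (Finset.card_image_of_injective _ Nat.cast_injective).symm
      rw [hU]
      rcases le_total 0 e with hpos | hneg
      · have hEc' : (Finset.Ico (m : ℤ) (m + E)).card = E := by simp
        calc _ ≤ (U.image (fun j : ℕ => (j : ℤ)) ∪ Finset.Ico (m : ℤ) (m + E)).card := ?_
          _ ≤ _ := (Finset.card_union_le _ _).trans (by rw [hEc'])
        apply Finset.card_le_card
        intro v hv
        obtain ⟨j, hj, rfl⟩ := Finset.mem_image.1 hv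
        simp only [V, Finset.mem_sdiff, Finset.mem_filter, Finset.mem_range] at hj
        obtain ⟨⟨hjm, hj1⟩, hj2⟩ := hj
        rw [abs_of_nonneg hpos] at he
        have hj3 : x + (j : ℤ) + e ∉ A 0 := fun h => hj2 ⟨hjm, hj1, h⟩
        by_cases hlt : (j : ℤ) + e < m
        · apply Finset.mem_union_left
          refine Finset.mem_image.2 ⟨((j : ℤ) + e).toNat, ?_, by simp; omega⟩
          simp only [U, Finset.mem_filter, Finset.mem_range]
          have hc : (((j : ℤ) + e).toNat : ℤ) = j + e := by simp; omega
          rw [hc]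
          refine ⟨by omega, ?_, ?_⟩
          · have : x + (j + e) - e = x + j := by ring
            rwa [this]
          · rwa [← add_assoc]
        · apply Finset.mem_union_right
          simp only [Finset.mem_Ico]
          omega
      · have hEc' : (Finset.Ico (-(E : ℤ)) 0).card = E := by simp
        calc _ ≤ (U.image (fun j : ℕ => (j : ℤ)) ∪ Finset.Ico (-(E : ℤ)) 0).card := ?_
          _ ≤ _ := (Finset.card_union_le _ _).trans (by rw [hEc'])
        apply Finset.card_le_card
        intro v hv
        obtain ⟨j, hj, rfl⟩ := Finset.mem_image.1 hv
        simp only [V, Finset.mem_sdiff, Finset.mem_filter, Finset.mem_range] at hj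
        obtain ⟨⟨hjm, hj1⟩, hj2⟩ := hj
        rw [abs_of_nonpos hneg] at he
        have hj3 : x + (j : ℤ) + e ∉ A 0 := fun h => hj2 ⟨hjm, hj1, h⟩
        by_cases hlt : 0 ≤ (j : ℤ) + e
        · apply Finset.mem_union_left
          refine Finset.mem_image.2 ⟨((j : ℤ) + e).toNat, ?_, by simp; omega⟩
          simp only [U, Finset.mem_filter, Finset.mem_range]
          have hc : (((j : ℤ) + e).toNat : ℤ) = j + e := by simp; omega
          rw [hc]
          refine ⟨by omega, ?_, ?_⟩
          · have : x + (j + e) - e = x + j := by ring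
            rwa [this]
          · rwa [← add_assoc]
        · apply Finset.mem_union_right
          simp only [Finset.mem_Ico]
          omega
    have hle := Finset.card_le_card_sdiff_add_card
      (s := (Finset.range m).filter fun j : ℕ => x + (j : ℤ) ∈ A 1) (t := V)
    omega
  rw [Fin.sum_univ_succ, Fin.sum_univ_succ, Fin.sum_univ_succ (n := n + 1),
    Fin.sum_univ_succ (n := n)]
  have h2 : ∀ i : Fin n, dys A e i.succ.succ = A i.succ.succ := fun i => rfl
  simp only [h2, Fin.succ_zero_eq_one]
  omega

open Classical in
lemma max_step {C : Set ℤ} {n : ℕ} {A : Fin (n + 2) → Set ℤ} (hA : Tup C A)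
    (x : ℤ) (m N E : ℕ) : ∃ A' : Fin (n + 2) → Set ℤ, Tup C A' ∧
      N * ∑ i, cnt (A i) x m ≤ N * ∑ i, cnt (A' i) x m + m ∧
      ∀ e : ℤ, |e| ≤ E → (∃ y ∈ A' 1, y + e ∈ A' 0) →
        ((Finset.range m).filter fun j : ℕ => x + j - e ∈ A' 1 ∧ x + j ∉ A' 0).card ≤ N * E := by
  set Ψ : (Fin (n + 2) → Set ℤ) → ℕ := fun A => N * ∑ i, cnt (A i) x m + cnt (A 0) x m with hΨ
  set S : Set ℕ := {k | ∃ A : Fin (n + 2) → Set ℤ, Tup C A ∧ Ψ A = k} with hS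
  have hSne : S.Nonempty := ⟨Ψ A, A, hA, rfl⟩
  have hSb : BddAbove S := by
    refine ⟨N * ((n + 2) * m) + m, ?_⟩
    rintro k ⟨A, -, rfl⟩
    have h1 : ∑ i, cnt (A i) x m ≤ (n + 2) * m := by
      calc _ ≤ ∑ i : Fin (n + 2), m := Finset.sum_le_sum fun i _ => cnt_le _ _ _
        _ = _ := by simp
    have := cnt_le (A 0) x m
    have := Nat.mul_le_mul_left N h1
    simp only [hΨ]
    omega
  obtain ⟨A', hA', hmax⟩ := Nat.sSup_mem hSne hSb
  have hle : ∀ A, Tup C A → Ψ A ≤ Ψ A' := fun A hA => by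
    rw [hmax]; exact le_csSup hSb ⟨A, hA, rfl⟩
  refine ⟨A', hA', ?_, ?_⟩
  · have h1 := hle A hA
    have := cnt_le (A' 0) x m
    simp only [hΨ] at h1
    omega
  · intro e he hy
    have h1 := hle _ (hA'.dys e hy)
    obtain ⟨h2, h3⟩ := dys_cnt A' e x m E he
    simp only [hΨ] at h1
    have h4 := Nat.mul_le_mul_left N h3
    rw [mul_add] at h4
    omega

end Tuples

section Blocks

lemma sum_blocks (c : ℕ → ℕ) (l M : ℕ) :
    ∑ j ∈ Finset.range (M * l), c j
      = ∑ s ∈ Finset.range M, ∑ j ∈ Finset.range l, c (s * l + j) := by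
  induction M with
  | zero => simp
  | succ M ih =>
    rw [Finset.sum_range_succ, ← ih, Nat.succ_mul, Finset.sum_range_add]

lemma block (l k N R b : ℕ) (hl : 1 ≤ l) :
    ∃ w : ℕ, ∀ m, w ≤ m → ∀ c : ℕ → ℕ, (∀ j, c j ≤ R) → ∀ bad : Finset ℕ, bad.card ≤ b →
      2 * N * m ≤ 2 * N * ∑ j ∈ Finset.range m, c j + m →
      ∃ s, s + k * l ≤ m ∧ (∀ j ∈ bad, ¬ (s ≤ j ∧ j < s + k * l)) ∧
        N * l ≤ N * ∑ j ∈ Finset.range l, c (s + j) + l := by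
  classical
  refine ⟨2 * ((k + b * k) * (N * (R * l) + l)) + 2 * (N * (R * l)) + 2 * l, ?_⟩
  intro m hm c hc bad hbad hsum
  by_contra hcon
  push Not at hcon
  set M := m / l with hM
  have hMl : M * l ≤ m := Nat.div_mul_le_self m l
  have hMl' : m < M * l + l := by
    have := Nat.lt_div_mul_add (a := m) hl
    simpa [hM] using this
  set W : ℕ → ℕ := fun s => ∑ j ∈ Finset.range l, c (s * l + j) with hW
  have hWle : ∀ s, W s ≤ R * l := by
    intro s
    calc W s ≤ ∑ j ∈ Finset.range l, R := Finset.sum_le_sum fun j _ => hc _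
      _ = R * l := by simp [mul_comm]
  set B1 : Finset ℕ := Finset.Ico (M + 1 - k) (M + 1) with hB1
  set B2 : Finset ℕ := bad.biUnion fun j => Finset.Ico (j / l + 1 - k) (j / l + 1) with hB2
  have hB1c : B1.card ≤ k := by simp [hB1]; omega
  have hB2c : B2.card ≤ b * k := by
    refine (Finset.card_biUnion_le_card_mul bad _ k ?_).trans (Nat.mul_le_mul_right _ hbad)
    intro j _
    simp; omega
  set BS := B1 ∪ B2 with hBS
  have hBSc : BS.card ≤ k + b * k := (Finset.card_union_le _ _).trans (by omega)
  have hpt : ∀ s ∈ Finset.range M, N * W s + l ≤ N * l +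
      if s ∈ BS then N * (R * l) + l else 0 := by
    intro s hs
    rw [Finset.mem_range] at hs
    split_ifs with hsB
    · have := Nat.mul_le_mul_left N (hWle s)
      omega
    · have h1 : s ∉ B1 := fun h => hsB (Finset.mem_union_left _ h)
      have h2 : s ∉ B2 := fun h => hsB (Finset.mem_union_right _ h)
      have h3 : s + k ≤ M := by
        simp only [hB1, Finset.mem_Ico] at h1
        omega
      have h4 : s * l + k * l ≤ m := by
        rw [← add_mul]
        exact (Nat.mul_le_mul_right l h3).trans hMl
      have h5 := hcon (s * l) h4 (by
        intro j hj hj1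
        by_contra hj2
        push Not at hj2
        apply h2
        simp only [hB2, Finset.mem_biUnion, Finset.mem_Ico]
        refine ⟨j, hj, ?_, ?_⟩
        · rw [← add_mul] at hj2
          have := (Nat.div_lt_iff_lt_mul hl).2 hj2
          omega
        · have := (Nat.le_div_iff_mul_le hl).2 hj1
          omega)
      simp only [hW]
      omega
  have hS := Finset.sum_le_sum hpt
  rw [Finset.sum_add_distrib, Finset.sum_add_distrib, ← Finset.mul_sum] at hS
  simp only [Finset.sum_const, Finset.card_range, smul_eq_mul] at hS
  have hite : ∑ s ∈ Finset.range M, (if s ∈ BS then N * (R * l) + l else 0)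
      ≤ (k + b * k) * (N * (R * l) + l) := by
    rw [← Finset.sum_filter, Finset.sum_const, smul_eq_mul]
    apply Nat.mul_le_mul_right
    refine le_trans (Finset.card_le_card ?_) hBSc
    intro s hs
    exact (Finset.mem_filter.1 hs).2
  have htail : ∑ j ∈ Finset.range m, c j ≤ ∑ s ∈ Finset.range M, W s + R * l := by
    have h1 : m = M * l + (m - M * l) := by omega
    rw [h1, Finset.sum_range_add, sum_blocks]
    apply Nat.add_le_add_left
    calc _ ≤ ∑ j ∈ Finset.range (m - M * l), R := Finset.sum_le_sum fun j _ => hc _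
      _ = R * (m - M * l) := by simp [mul_comm]
      _ ≤ R * l := Nat.mul_le_mul_left _ (by omega)
  have h6 := Nat.mul_le_mul_left N htail
  have h7 : M * (N * l) ≤ N * m := by
    calc M * (N * l) = N * (M * l) := by ring
      _ ≤ _ := Nat.mul_le_mul_left _ hMl
  rw [mul_add] at h6
  rw [mul_assoc, mul_assoc] at hsum
  omega

end Blocks

section Periodic

open Classical in
/-- multiplicity function of a tuple -/
noncomputable def mult {r : ℕ} (A : Fin r → Set ℤ) (x : ℤ) (j : ℕ) : ℕ :=
  ∑ i, if x + (j : ℤ) ∈ A i then 1 else 0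

lemma mult_le {r : ℕ} (A : Fin r → Set ℤ) (x : ℤ) (j : ℕ) : mult A x j ≤ r := by
  classical
  calc mult A x j ≤ ∑ i : Fin r, 1 := Finset.sum_le_sum fun i _ => by split_ifs <;> simp
    _ = r := by simp

lemma sum_mult {r : ℕ} (A : Fin r → Set ℤ) (x : ℤ) (s m : ℕ) :
    ∑ j ∈ Finset.range m, mult A x (s + j) = ∑ i, cnt (A i) (x + s) m := by
  classical
  unfold mult cnt
  rw [Finset.sum_comm]
  refine Finset.sum_congr rfl fun i _ => ?_
  rw [Finset.card_filter]
  refine Finset.sum_congr rfl fun j _ => ?_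
  push_cast
  rw [add_assoc]

lemma sum_mult' {r : ℕ} (A : Fin r → Set ℤ) (x : ℤ) (m : ℕ) :
    ∑ j ∈ Finset.range m, mult A x j = ∑ i, cnt (A i) x m := by
  have := sum_mult A x 0 m
  simpa using this

/-- The conclusion of the structure theorem. -/
def PerStruct (C : Set ℤ) (r w : ℕ) : Prop :=
  ∃ n ≤ r, ∃ g : ℕ, 1 ≤ g ∧ ∃ Q : Fin (n + 1) → Finset (ZMod g), (∀ i, (Q i).Nonempty) ∧
    g ≤ ∑ i, (Q i).card ∧ ∃ (z' : ℤ) (z : ZMod g), ∀ v : ℤ, z' ≤ v → v < z' + w →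
      (∃ a : Fin (n + 1) → ZMod g, (∀ i, a i ∈ Q i) ∧ (v : ZMod g) = z + ∑ i, a i) → v ∈ C

lemma perStruct_zero (C : Set ℤ) (h : Good C 1) (w : ℕ) : PerStruct C 0 w := by
  classical
  obtain ⟨w0, hw0⟩ := block (w + 1) 1 (w + 2) 1 0 (by omega)
  obtain ⟨A, ⟨-, z, hz⟩, x, m, hm, hd⟩ := h (2 * (w + 2)) w0
  rw [← sum_mult'] at hd
  obtain ⟨s, -, -, hs⟩ := hw0 m hm (mult A x) (mult_le A x) ∅ (by simp) hd
  rw [sum_mult] at hs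
  simp only [Fin.sum_univ_one] at hs
  have hfull : cnt (A 0) (x + s) (w + 1) = w + 1 := by
    have h1 := cnt_le (A 0) (x + s) (w + 1)
    by_contra hne
    have h2 : cnt (A 0) (x + s) (w + 1) ≤ w := by omega
    have := Nat.mul_le_mul_left (w + 2) h2
    nlinarith
  have hall : ∀ j < w + 1, x + s + (j : ℤ) ∈ A 0 := by
    intro j hj
    unfold cnt at hfull
    have := Finset.filter_card_eq (s := Finset.range (w + 1)) (by simpa using hfull) j
      (by simpa using hj)
    exact this
  refine ⟨0, le_rfl, 1, le_rfl, fun _ => {0}, by simp, by simp, z + (x + s), 0, ?_⟩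
  intro v hv1 hv2 _
  have h1 := hall (v - (z + (x + s))).toNat (by omega)
  have h2 := hz (fun _ => v - z) (by
    intro i
    rw [Fin.fin_one_eq_zero i]
    have : x + s + ((v - (z + (x + s))).toNat : ℤ) = v - z := by
      rw [Int.toNat_of_nonneg (by omega)]; ring
    rwa [this] at h1)
  simpa using h2

end Periodic

section Structure

lemma period_of_dense (S : Set ℤ) (x : ℤ) (P l : ℕ) (hP : 1 ≤ P) (hdvd : P ∣ l)
    (h : l < P * cnt S x l) :
    ∃ j g : ℕ, 1 ≤ g ∧ g < P ∧ j + g < l ∧ x + (j : ℤ) ∈ S ∧ x + (j : ℤ) + (g : ℤ) ∈ S := by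
  classical
  obtain ⟨q, rfl⟩ := hdvd
  have hq : q < cnt S x (P * q) := Nat.lt_of_mul_lt_mul_left h
  unfold cnt at hq
  obtain ⟨a, ha, b, hb, hab, hf⟩ := Finset.exists_ne_map_eq_of_card_lt_of_maps_to
    (t := Finset.range q) (f := fun j => j / P) (by simpa using hq) (by
      intro j hj
      simp only [Finset.coe_filter, Finset.mem_range, Set.mem_ofPred_eq] at hj
      simp only [Finset.coe_range, Set.mem_Iio]
      exact Nat.div_lt_of_lt_mul hj.1)
  simp only [Finset.mem_filter, Finset.mem_range] at ha hb
  have h1 := Nat.div_add_mod a P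
  have h2 := Nat.div_add_mod b P
  have h3 := Nat.mod_lt a hP
  have h4 := Nat.mod_lt b hP
  rw [hf] at h1
  rcases lt_or_gt_of_ne hab with hlt | hlt
  · refine ⟨a, b - a, by omega, by omega, by omega, ha.2, ?_⟩
    have : x + (a : ℤ) + ((b - a : ℕ) : ℤ) = x + b := by omega
    rw [this]; exact hb.2
  · refine ⟨b, a - b, by omega, by omega, by omega, hb.2, ?_⟩
    have : x + (b : ℤ) + ((a - b : ℕ) : ℤ) = x + a := by omega
    rw [this]; exact ha.2

open Classical in
/-- residues mod `g` of the part of `S` in a window -/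
noncomputable def resid (S : Set ℤ) (x : ℤ) (l g : ℕ) : Finset (ZMod g) :=
  ((Finset.range l).filter fun j : ℕ => x + (j : ℤ) ∈ S).image
    fun j : ℕ => ((x + (j : ℤ) : ℤ) : ZMod g)

lemma mem_resid {S : Set ℤ} {x : ℤ} {l g : ℕ} {a : ZMod g} (h : a ∈ resid S x l g) :
    ∃ u : ℤ, x ≤ u ∧ u < x + l ∧ u ∈ S ∧ (u : ZMod g) = a := by
  classical
  unfold resid at h
  simp only [Finset.mem_image, Finset.mem_filter, Finset.mem_range] at h
  obtain ⟨j, ⟨hj, hS⟩, rfl⟩ := h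
  exact ⟨x + j, by omega, by omega, hS, rfl⟩

lemma cnt_le_resid (S : Set ℤ) (x : ℤ) (q g : ℕ) (hg : 1 ≤ g) :
    cnt S x (g * q) ≤ q * (resid S x (g * q) g).card := by
  classical
  unfold cnt resid
  refine Finset.card_le_mul_card_image _ q ?_
  intro b _
  refine le_of_le_of_eq ?_ (Finset.card_range q)
  refine Finset.card_le_card_of_injOn (fun j => j / g) ?_ ?_
  · intro j hj
    simp only [Finset.coe_filter, Finset.mem_filter, Finset.mem_range, Set.mem_ofPred_eq] at hj
    simp only [Finset.coe_range, Set.mem_Iio]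
    exact Nat.div_lt_of_lt_mul hj.1.1
  · intro i hi j hj hij
    simp only [Finset.coe_filter, Finset.mem_filter, Finset.mem_range, Set.mem_ofPred_eq] at hi hj
    have h1 : ((x + (i : ℤ) : ℤ) : ZMod g) = ((x + (j : ℤ) : ℤ) : ZMod g) := hi.2.trans hj.2.symm
    push_cast at h1
    have h2 := add_left_cancel h1
    rw [ZMod.natCast_eq_natCast_iff] at h2
    dsimp at hij
    rw [← Nat.div_add_mod i g, ← Nat.div_add_mod j g, hij, h2]

lemma per_final {C : Set ℤ} {r : ℕ} {A : Fin (r + 2) → Set ℤ} {z0 : ℤ}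
    (hz : ∀ a : Fin (r + 2) → ℤ, (∀ i, a i ∈ A i) → z0 + ∑ i, a i ∈ C)
    (x : ℤ) (l g w : ℕ) (hg : 1 ≤ g) (hw : w ≤ l)
    (hup : ∀ u : ℤ, x ≤ u → u + g < x + (2 * (r + 2) * l : ℕ) → u ∈ A 0 → u + g ∈ A 0)
    (hne : ∀ i, (resid (A i) x l g).Nonempty)
    (hcard : g ≤ ∑ i, (resid (A i) x l g).card) : PerStruct C (r + 1) w := by
  refine ⟨r + 1, le_rfl, g, hg, fun i => resid (A i) x l g, hne, hcard,
    (r + 2) * x + (r + 2) * l + z0, (z0 : ZMod g), ?_⟩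
  rintro v hv1 hv2 ⟨a, ha, hva⟩
  have hrep := fun i => mem_resid (ha i)
  choose ρ h1 h2 h3 h4 using hrep
  set σ : ℤ := ∑ i : Fin (r + 1), ρ i.succ with hσ
  have hs1 : (r + 1) * x ≤ σ := by
    have := Finset.sum_le_sum fun (i : Fin (r + 1)) (_ : i ∈ Finset.univ) => h1 i.succ
    simpa [hσ] using this
  have hs2 : σ ≤ (r + 1) * (x + l) := by
    have := Finset.sum_le_sum fun (i : Fin (r + 1)) (_ : i ∈ Finset.univ) => (h2 i.succ).le
    simpa [hσ] using this
  set u : ℤ := v - z0 - σ with hu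
  have hu1 : x + l ≤ u := by
    simp only [hu]; linarith
  have hlw : (w : ℤ) ≤ l := by exact_mod_cast hw
  have hu2 : u < x + (2 * (r + 2) * l : ℕ) := by
    simp only [hu]
    push_cast
    have : 0 ≤ (r : ℤ) * l := by positivity
    linarith
  have hcong : (u : ZMod g) = (ρ 0 : ZMod g) := by
    simp only [hu, hσ]
    push_cast
    rw [hva, Fin.sum_univ_succ, ← h4 0]
    simp only [h4]
    ring
  have hmem : ∀ t : ℕ, ρ 0 + t * g < x + (2 * (r + 2) * l : ℕ) → ρ 0 + t * g ∈ A 0 := by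
    intro t
    induction t with
    | zero => intro _; simpa using h3 0
    | succ t ih =>
      intro ht
      have e : ρ 0 + ((t + 1 : ℕ) : ℤ) * g = ρ 0 + t * g + g := by push_cast; ring
      rw [e] at ht ⊢
      have h0 : (0 : ℤ) ≤ t * g := by positivity
      exact hup _ (by linarith [h1 0]) ht (ih (by linarith))
  have huA : u ∈ A 0 := by
    have hd : (g : ℤ) ∣ u - ρ 0 := by
      exact (ZMod.intCast_eq_intCast_iff_dvd_sub _ _ _).1 hcong.symm
    obtain ⟨t, ht⟩ := hd
    have ht0 : 0 ≤ t := by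
      by_contra hneg
      push Not at hneg
      have : (g : ℤ) * t < 0 := mul_neg_of_pos_of_neg (by exact_mod_cast hg) hneg
      linarith [h2 0]
    lift t to ℕ using ht0
    have e : u = ρ 0 + t * g := by linarith
    rw [e]
    exact hmem t (by rw [← e]; exact hu2)
  have := hz (Fin.cons u fun i => ρ i.succ) (by
    intro i
    refine Fin.cases ?_ (fun j => ?_) i
    · simpa using huA
    · simpa using h3 j.succ)
  rw [Fin.sum_univ_succ] at this
  simp only [Fin.cons_zero, Fin.cons_succ] at this
  have e : z0 + (u + ∑ i : Fin (r + 1), ρ i.succ) = v := by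
    rw [← hσ, hu]; ring
  rwa [e] at this

lemma perStruct (C : Set ℤ) (r : ℕ) (h : Good C (r + 1)) (w : ℕ) : PerStruct C r w := by
  classical
  induction r with
  | zero => exact perStruct_zero C h w
  | succ r ih =>
    by_cases hG : Good C (r + 1)
    · obtain ⟨n, hn, rest⟩ := ih hG
      exact ⟨n, by omega, rest⟩
    unfold Good at hG
    push Not at hG
    obtain ⟨N1, w1, hG⟩ := hG
    set P := 2 * N1 + 2 with hP
    set l := P.factorial * (w1 + w + 1) with hl
    have hPf : 1 ≤ P.factorial := Nat.factorial_pos P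
    have hlw : w1 + w + 1 ≤ l := Nat.le_mul_of_pos_left _ hPf
    set k := 2 * (r + 2) with hk
    set E := k * l with hE
    obtain ⟨w0, hw0⟩ := block l k P (r + 2) ((2 * E + 1) * (4 * P * E)) (by omega)
    obtain ⟨A0, hA0, x0, m, hm, hd0⟩ := h (4 * P) w0
    obtain ⟨A, hA, hd, hmax⟩ := max_step hA0 x0 m (4 * P) E
    set U : ℤ → Finset ℕ := fun e =>
      (Finset.range m).filter fun j : ℕ => x0 + j - e ∈ A 1 ∧ x0 + j ∉ A 0 with hU
    set Es : Finset ℤ := (Finset.Icc (-(E : ℤ)) E).filter fun e => ∃ y ∈ A 1, y + e ∈ A 0 with hEs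
    have hbad : (Es.biUnion U).card ≤ (2 * E + 1) * (4 * P * E) := by
      refine (Finset.card_biUnion_le_card_mul Es U (4 * P * E) ?_).trans
        (Nat.mul_le_mul_right _ ?_)
      · intro e he
        simp only [hEs, Finset.mem_filter, Finset.mem_Icc] at he
        exact hmax e (abs_le.2 he.1) he.2
      · refine (Finset.card_filter_le _ _).trans ?_
        rw [Int.card_Icc]; omega
    have hdd : 2 * P * m ≤ 2 * P * ∑ i, cnt (A i) x0 m + m := by
      have := hd0.trans (Nat.add_le_add_right hd m)
      have e1 : 4 * P * m = 2 * (2 * P * m) := by ring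
      have e2 : 4 * P * ∑ i, cnt (A i) x0 m = 2 * (2 * P * ∑ i, cnt (A i) x0 m) := by ring
      omega
    rw [← sum_mult'] at hdd
    obtain ⟨s, hs1, hs2, hs3⟩ := hw0 m hm (mult A x0) (mult_le A x0) _ hbad hdd
    rw [sum_mult] at hs3
    set x : ℤ := x0 + s with hx
    have hdense : ∀ i, l < P * cnt (A i) x l := by
      intro i
      have h1 := hG _ (hA.drop i) x l (by omega)
      rw [Fin.sum_univ_succAbove _ i] at hs3
      set T := ∑ j, cnt (A (i.succAbove j)) x l
      have hN1 : N1 * T + l < N1 * l := h1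
      have e1 : P * l = 2 * (N1 * l) + 2 * l := by rw [hP]; ring
      have e2 : P * (cnt (A i) x l + T) = P * cnt (A i) x l + (2 * (N1 * T) + 2 * T) := by
        rw [hP]; ring
      have hT : T < l := by
        by_contra hc
        push Not at hc
        have := Nat.mul_le_mul_left N1 hc
        omega
      omega
    obtain ⟨j1, g, hg1, hgP, hjg, hm1, hm2⟩ := period_of_dense (A 1) x P l (by omega)
      ((Nat.dvd_factorial (by omega) le_rfl).mul_right _) (hdense 1)
    obtain ⟨q, hq⟩ : g ∣ l := (Nat.dvd_factorial (by omega) hgP.le).mul_right _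
    obtain ⟨-, z0, hz⟩ := hA
    have hl0 : 1 ≤ l := by omega
    have hcr : ∀ i, cnt (A i) x l ≤ q * (resid (A i) x l g).card := by
      intro i
      rw [hq]; exact cnt_le_resid (A i) x q g hg1
    refine per_final hz x l g w hg1 (by omega) ?_ ?_ ?_
    · intro u hu1 hu2 huA
      by_contra hun
      have hgz : (1 : ℤ) ≤ g := by exact_mod_cast hg1
      have hEl : l ≤ E := by rw [hE, hk]; nlinarith
      have hEe : (2 * (r + 2) * l : ℕ) = E := by rw [hE]
      rw [hEe] at hu2
      obtain ⟨t, ht⟩ : ∃ t : ℕ, u + g = x0 + t := ⟨(u + g - x0).toNat, by omega⟩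
      refine hs2 t ?_ ⟨by omega, by rw [← hE]; omega⟩
      rw [Finset.mem_biUnion]
      refine ⟨u - (x + j1), ?_, ?_⟩
      · simp only [hEs, Finset.mem_filter, Finset.mem_Icc]
        refine ⟨⟨by omega, by omega⟩, x + j1, hm1, ?_⟩
        rw [add_sub_cancel]; exact huA
      · simp only [hU, Finset.mem_filter, Finset.mem_range]
        have hsm : s + E ≤ m := hs1
        refine ⟨by omega, ?_, ?_⟩
        · rw [← ht]
          have : u + g - (u - (x + j1)) = x + j1 + g := by ring
          rw [this]; exact hm2
        · rw [← ht]; exact hun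
    · intro i
      rw [Finset.nonempty_iff_ne_empty]
      intro he
      have h1 := hcr i
      have h2 := hdense i
      rw [he] at h1
      simp only [Finset.card_empty, mul_zero, Nat.le_zero] at h1
      rw [h1] at h2
      omega
    · have h1 : ∑ i, cnt (A i) x l ≤ q * ∑ i, (resid (A i) x l g).card := by
        rw [Finset.mul_sum]; exact Finset.sum_le_sum fun i _ => hcr i
      by_contra hlt
      push Not at hlt
      set K := ∑ i, (resid (A i) x l g).card
      have hK : q * K + q ≤ g * q := by
        have := Nat.mul_le_mul_left q hlt
        linarith [mul_comm g q, Nat.mul_succ q K]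
      have hq0 : 1 ≤ q := by
        rcases Nat.eq_zero_or_pos q with h0 | h0
        · rw [h0] at hq; omega
        · exact h0
      have h2 := Nat.mul_le_mul_left P h1
      have h3 := Nat.mul_le_mul_left P hK
      rw [mul_add] at h3
      have h4 : P * l = P * (g * q) := by rw [← hq]
      have h5 : l < P * q := by rw [hq]; exact Nat.mul_lt_mul_of_pos_right hgP hq0
      omega

end Structure

section Core

lemma foldSum_add {B : Set ℤ} {i j : ℕ} {a b : ℤ} (ha : a ∈ foldSum i B) (hb : b ∈ foldSum j B) :
    a + b ∈ foldSum (i + j) B := by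
  obtain ⟨f, hf, rfl⟩ := ha
  obtain ⟨f', hf', rfl⟩ := hb
  refine ⟨Fin.append f f', ?_, ?_⟩
  · intro k
    refine Fin.addCases (fun k => ?_) (fun k => ?_) k
    · simpa using hf k
    · simpa using hf' k
  · simp [Fin.sum_univ_add]

lemma zero_mem_foldSum {B : Set ℤ} (h0 : (0 : ℤ) ∈ B) (i : ℕ) : (0 : ℤ) ∈ foldSum i B :=
  ⟨fun _ => 0, fun _ => h0, by simp⟩

lemma foldSum_mono {B : Set ℤ} (h0 : (0 : ℤ) ∈ B) {i j : ℕ} (hij : i ≤ j) {a : ℤ}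
    (ha : a ∈ foldSum i B) : a ∈ foldSum j B := by
  obtain ⟨k, rfl⟩ := Nat.exists_eq_add_of_le hij
  simpa using foldSum_add ha (zero_mem_foldSum h0 k)

lemma foldSum_sum {B : Set ℤ} {r : ℕ} (k : Fin r → ℕ) (a : Fin r → ℤ)
    (h : ∀ i, a i ∈ foldSum (k i) B) : ∑ i, a i ∈ foldSum (∑ i, k i) B := by
  induction r with
  | zero => exact ⟨fun _ => 0, by intro i; simp at i; exact i.elim0, by simp⟩
  | succ r ih =>
    rw [Fin.sum_univ_succ, Fin.sum_univ_succ]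
    exact foldSum_add (h 0) (ih _ _ fun i => h i.succ)

/-- `S` meets every far out interval of some fixed length. -/
def Synd (S : Set ℤ) : Prop :=
  ∃ (L : ℕ) (N : ℤ), ∀ x, N ≤ x → ∃ d ∈ S, x ≤ d ∧ d < x + L

lemma good_of_not_synd {B : Set ℤ} (h0 : (0 : ℤ) ∈ B) (p ρ : ℕ) (t : ℕ → ℤ) (T : ℕ)
    (hT : ∀ j ≤ p + 1 + ρ, |t j| ≤ T) (N0 : ℤ)
    (hcov : ∀ N, N0 ≤ N → ∃ j ≤ p + 1 + ρ, N - t j ∈ foldSum j B)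
    (hns : ¬ Synd (foldSum p B)) :
    Good (foldSum (∑ k : Fin (ρ + 1), (p + 1 + k)) B) (ρ + 1) := by
  classical
  intro N w
  unfold Synd at hns
  push Not at hns
  obtain ⟨x, hx, hgap⟩ := hns (w + 2 * T + 1) N0
  set A : Fin (ρ + 1) → Set ℤ := fun k => {v | v - t (p + 1 + k) ∈ foldSum (p + 1 + k) B} with hA
  refine ⟨A, ⟨?_, -∑ k : Fin (ρ + 1), t (p + 1 + k), ?_⟩, x + T, w, le_rfl, ?_⟩
  · intro k
    exact ⟨t (p + 1 + k), by simpa [hA] using zero_mem_foldSum h0 _⟩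
  · intro a ha
    have := foldSum_sum (B := B) (fun k : Fin (ρ + 1) => p + 1 + (k : ℕ))
      (fun k => a k - t (p + 1 + k)) ha
    rw [Finset.sum_sub_distrib] at this
    rwa [neg_add_eq_sub]
  · refine le_trans (Nat.mul_le_mul_left N ?_) (Nat.le_add_right _ _)
    rw [← sum_mult']
    have : ∀ j ∈ Finset.range w, 1 ≤ mult A (x + T) j := by
      intro j hj
      rw [Finset.mem_range] at hj
      obtain ⟨i, hi, hmem⟩ := hcov (x + T + j) (by omega)
      have hTi := abs_le.1 (hT i hi)
      have hpi : p + 1 ≤ i := by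
        by_contra hlt
        have h1 := foldSum_mono h0 (show i ≤ p by omega) hmem
        have h2 := hgap _ h1 (by omega)
        push_cast at h2
        omega
      obtain ⟨k, rfl⟩ := Nat.exists_eq_add_of_le hpi
      have hk : k < ρ + 1 := by omega
      unfold mult
      refine le_trans ?_ (Finset.single_le_sum (fun _ _ => Nat.zero_le _)
        (Finset.mem_univ (⟨k, hk⟩ : Fin (ρ + 1))))
      have hin : x + T + (j : ℤ) ∈ A ⟨k, hk⟩ := hmem
      rw [if_pos hin]
    calc w = ∑ j ∈ Finset.range w, 1 := by simp
      _ ≤ _ := Finset.sum_le_sum this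

lemma gen_finset {B : Set ℤ} (h0 : (0 : ℤ) ∈ B) {m : ℕ} (hm : RepBy B m) :
    ∃ F : Finset ℤ, (∀ f ∈ F, f ∈ B) ∧ 0 ∈ F ∧ ∀ g : ℕ,
      AddSubgroup.closure ((F.image (fun f : ℤ => (f : ZMod g)) : Finset (ZMod g)) : Set (ZMod g))
        = ⊤ := by
  classical
  obtain ⟨N, hN⟩ := Filter.eventually_atTop.1 hm
  obtain ⟨f1, hf1, hs1⟩ := hN N le_rfl
  obtain ⟨f2, hf2, hs2⟩ := hN (N + 1) (by omega)
  set F : Finset ℤ := insert 0 (Finset.univ.image f1 ∪ Finset.univ.image f2) with hF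
  refine ⟨F, ?_, by simp [hF], ?_⟩
  · intro f hf
    simp only [hF, Finset.mem_insert, Finset.mem_union, Finset.mem_image, Finset.mem_univ,
      true_and] at hf
    rcases hf with rfl | ⟨i, rfl⟩ | ⟨i, rfl⟩
    · exact h0
    · exact hf1 i
    · exact hf2 i
  · intro g
    set K := AddSubgroup.closure
      ((F.image (fun f : ℤ => (f : ZMod g)) : Finset (ZMod g)) : Set (ZMod g)) with hK
    have hmem : ∀ f ∈ F, (f : ZMod g) ∈ K := by
      intro f hf
      apply AddSubgroup.subset_closure
      exact Finset.mem_coe.2 (Finset.mem_image_of_mem _ hf)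
    have h1 : (1 : ZMod g) ∈ K := by
      have e : (1 : ZMod g) = ∑ i, (f2 i : ZMod g) - ∑ i, (f1 i : ZMod g) := by
        have : (1 : ℤ) = ∑ i, f2 i - ∑ i, f1 i := by rw [hs1, hs2]; ring
        have := congrArg (fun z : ℤ => (z : ZMod g)) this
        push_cast at this
        exact this
      rw [e]
      refine K.sub_mem (K.sum_mem fun i _ => hmem _ ?_) (K.sum_mem fun i _ => hmem _ ?_)
      · simp [hF]
      · simp [hF]
    rw [eq_top_iff]
    intro a _
    obtain ⟨b, rfl⟩ := ZMod.intCast_surjective a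
    have := K.zsmul_mem h1 b
    simpa using this

theorem core_bound {B : Set ℤ} (h0 : (0 : ℤ) ∈ B) {m : ℕ} (hm : RepBy B m) (H : ℕ) (t : ℕ → ℤ)
    (hcov : ∀ᶠ N : ℤ in Filter.atTop, ∃ j ≤ H, N - t j ∈ foldSum j B) :
    RepBy B (H * (H + 3) / 2) := by
  classical
  obtain ⟨N0, hN0⟩ := Filter.eventually_atTop.1 hcov
  set T : ℕ := ∑ j ∈ Finset.range (H + 1), (t j).natAbs with hTdef
  have hT : ∀ j ≤ H, |t j| ≤ T := by
    intro j hj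
    have : (t j).natAbs ≤ T := Finset.single_le_sum (f := fun j => (t j).natAbs)
      (fun _ _ => Nat.zero_le _) (Finset.mem_range.2 (by omega))
    rw [Int.abs_eq_natAbs]
    exact_mod_cast this
  have hsH : Synd (foldSum H B) := by
    refine ⟨2 * T + 1, N0, fun x hx => ?_⟩
    obtain ⟨j, hj, hmem⟩ := hN0 (x + T) (by omega)
    have := abs_le.1 (hT j hj)
    exact ⟨_, foldSum_mono h0 hj hmem, by omega, by push_cast; omega⟩
  have hs0 : ¬ Synd (foldSum 0 B) := by
    rintro ⟨L, N, h⟩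
    obtain ⟨d, ⟨f, -, rfl⟩, hd, -⟩ := h (max N 1) (le_max_left _ _)
    have := le_max_right N 1
    simp at hd
  have hex : ∃ i, Synd (foldSum i B) := ⟨H, hsH⟩
  obtain ⟨i, hi⟩ : ∃ i, i = Nat.find hex := ⟨_, rfl⟩
  have hiS : Synd (foldSum i B) := hi ▸ Nat.find_spec hex
  have hiH : i ≤ H := hi ▸ Nat.find_min' hex hsH
  obtain _ | p := i
  · exact absurd hiS hs0
  have hns : ¬ Synd (foldSum p B) := Nat.find_min hex (by omega)
  obtain ⟨ρ, rfl⟩ := Nat.exists_eq_add_of_le hiH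
  have hgood := good_of_not_synd h0 p ρ t T hT N0 hN0 hns
  obtain ⟨F, hFB, hF0, hFgen⟩ := gen_finset h0 hm
  set M : ℕ := ∑ f ∈ F, f.natAbs with hM
  have hMf : ∀ f ∈ F, |f| ≤ (M : ℤ) := by
    intro f hf
    have : f.natAbs ≤ M := Finset.single_le_sum (f := fun j : ℤ => j.natAbs)
      (fun _ _ => Nat.zero_le _) hf
    rw [Int.abs_eq_natAbs]
    exact_mod_cast this
  obtain ⟨L, N1, hsyn⟩ := hiS
  set D : ℕ := ρ * M with hD
  set K' := ∑ k : Fin (ρ + 1), (p + 1 + (k : ℕ)) with hK'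
  obtain ⟨n, hn, g, hg, Q, hQne, hQc, z', z, hper⟩ :=
    perStruct _ ρ hgood (L + 2 * D + 1)
  have : NeZero g := ⟨by omega⟩
  have hnum : K' + (p + 1 + n) ≤ (p + 1 + ρ) * (p + 1 + ρ + 3) / 2 := by
    have h1 : K' = ∑ k ∈ Finset.range (ρ + 1), (p + 1 + k) := by
      rw [hK']; exact Fin.sum_univ_eq_sum_range (fun k => p + 1 + k) (ρ + 1)
    have h2 := Finset.sum_range_add (fun k => k) (p + 1) (ρ + 1)
    have h3 := Finset.sum_range_id_mul_two (p + 1 + (ρ + 1))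
    rw [h2, ← h1] at h3
    have e : p + 1 + (ρ + 1) - 1 = p + 1 + ρ := by omega
    rw [e] at h3
    have h4 : K' * 2 ≤ (p + 1 + (ρ + 1)) * (p + 1 + ρ) := by
      rw [← h3]
      exact Nat.mul_le_mul_right _ (Nat.le_add_left _ _)
    rw [Nat.le_div_iff_mul_le (by norm_num)]
    calc (K' + (p + 1 + n)) * 2 = K' * 2 + (p + 1 + n) * 2 := by ring
      _ ≤ (p + 1 + (ρ + 1)) * (p + 1 + ρ) + (p + 1 + ρ) * 2 := by
        apply Nat.add_le_add h4; omega
      _ = (p + 1 + ρ) * (p + 1 + ρ + 3) := by ring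
  refine Filter.eventually_atTop.2 ⟨N1 + z' + D + L, fun y hy => ?_⟩
  obtain ⟨d, hdS, hd1, hd2⟩ := hsyn (y - z' - D - L) (by linarith)
  obtain ⟨a, f, haQ, hfF, heq⟩ := tuple_full
    (F.image (fun f : ℤ => (f : ZMod g))) (Finset.mem_image.2 ⟨0, hF0, by simp⟩) (hFgen g) n Q hQne
    (by rw [ZMod.card]; exact hQc) (((y - d : ℤ) : ZMod g) - z)
  have hlift : ∀ i, ∃ φ ∈ F, (φ : ZMod g) = f i := by
    intro i
    simpa using hfF i
  choose φ hφF hφ using hlift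
  have hφb : |∑ i, φ i| ≤ (D : ℤ) := by
    calc |∑ i, φ i| ≤ ∑ i, |φ i| := Finset.abs_sum_le_sum_abs _ _
      _ ≤ ∑ i : Fin n, (M : ℤ) := Finset.sum_le_sum fun i _ => hMf _ (hφF i)
      _ = n * M := by simp
      _ ≤ ρ * M := by gcongr
      _ = D := by rw [hD]; push_cast; ring
  have hb := abs_le.1 hφb
  have hv := hper (y - d - ∑ i, φ i) (by linarith) (by push_cast; linarith) ⟨a, haQ, by
    push_cast
    simp only [hφ]
    push_cast at heq
    linear_combination heq⟩
  have hφS : ∑ i, φ i ∈ foldSum n B := ⟨φ, fun i => hFB _ (hφF i), rfl⟩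
  have := foldSum_add hv (foldSum_add hdS hφS)
  have e : y - d - ∑ i, φ i + (d + ∑ i, φ i) = y := by ring
  rw [e] at this
  exact foldSum_mono h0 hnum this

end Core

section Reduction

/-- translate of a set by `-y` -/
def shiftSet (B : Set ℤ) (y : ℤ) : Set ℤ := {b | b + y ∈ B}

lemma foldSum_shiftSet (B : Set ℤ) (y : ℤ) (j : ℕ) (z : ℤ) :
    z ∈ foldSum j (shiftSet B y) ↔ z + j * y ∈ foldSum j B := by
  constructor
  · rintro ⟨f, hf, rfl⟩
    exact ⟨fun i => f i + y, hf, by simp [Finset.sum_add_distrib]⟩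
  · rintro ⟨f, hf, hs⟩
    refine ⟨fun i => f i - y, fun i => by simpa [shiftSet] using hf i, ?_⟩
    rw [Finset.sum_sub_distrib, hs]
    simp

lemma repBy_shiftSet (B : Set ℤ) (y : ℤ) (j : ℕ) : RepBy (shiftSet B y) j ↔ RepBy B j := by
  unfold RepBy
  rw [Filter.eventually_atTop, Filter.eventually_atTop]
  constructor
  · rintro ⟨N, h⟩
    refine ⟨N + j * y, fun x hx => ?_⟩
    have := (foldSum_shiftSet B y j _).1 (h (x - j * y) (by linarith))
    simpa using this
  · rintro ⟨N, h⟩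
    exact ⟨N - j * y, fun x hx => (foldSum_shiftSet B y j _).2 (h _ (by linarith))⟩

lemma split_sum {B : Set ℤ} (p q : ℕ) (h : ℕ) (f : Fin h → ℤ)
    (hf : ∀ i, f i ∈ B ∨ (-(p : ℤ) ≤ f i ∧ f i ≤ q)) :
    ∃ k' k : ℕ, k' + k = h ∧ ∃ b ∈ foldSum k' B, ∃ t : ℤ, -((k : ℤ) * p) ≤ t ∧ t ≤ k * q ∧
      ∑ i, f i = b + t := by
  induction h with
  | zero => exact ⟨0, 0, rfl, 0, ⟨fun _ => 0, fun i => i.elim0, by simp⟩, 0, by simp⟩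
  | succ h ih =>
    obtain ⟨k', k, hk, b, hb, t, ht1, ht2, hs⟩ := ih (fun i => f i.succ) fun i => hf i.succ
    rw [Fin.sum_univ_succ, hs]
    rcases hf 0 with h0 | ⟨h1, h2⟩
    · refine ⟨1 + k', k, by omega, f 0 + b, foldSum_add ⟨fun _ => f 0, fun _ => h0, by simp⟩ hb,
        t, ht1, ht2, by ring⟩
    · exact ⟨k', k + 1, by omega, b, hb, f 0 + t, by push_cast; linarith, by push_cast; linarith,
        by ring⟩

/-- enumeration of the possible shifts -/
def tau (p q : ℕ) (s : ℕ) : ℤ :=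
  if s = 0 then 0 else
    if (s - 1) % (p + q) < q then ((s - 1) / (p + q) * q + (s - 1) % (p + q) + 1 : ℕ)
    else -((s - 1) / (p + q) * p + ((s - 1) % (p + q) - q) + 1 : ℕ)

lemma tau_eval (p q i u : ℕ) (hu : u < p + q) : tau p q (i * (p + q) + u + 1) =
    if u < q then ((i * q + u + 1 : ℕ) : ℤ) else -((i * p + (u - q) + 1 : ℕ) : ℤ) := by
  unfold tau
  have h1 : (i * (p + q) + u) % (p + q) = u := by
    rw [mul_comm, Nat.mul_add_mod, Nat.mod_eq_of_lt hu]
  have h2 : (i * (p + q) + u) / (p + q) = i := by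
    rw [mul_comm, Nat.mul_add_div (by omega), Nat.div_eq_of_lt hu, add_zero]
  simp only [Nat.add_sub_cancel, h1, h2]
  rw [if_neg (by omega)]

lemma tau_surj (p q k : ℕ) (x : ℤ) (h1 : -((k : ℤ) * p) ≤ x) (h2 : x ≤ k * q) :
    ∃ s ≤ k * (p + q), tau p q s = x := by
  have bound : ∀ i u, i < k → u < p + q → i * (p + q) + u + 1 ≤ k * (p + q) := by
    intro i u hi hu
    have := Nat.mul_le_mul_right (p + q) (Nat.succ_le_of_lt hi)
    rw [Nat.succ_mul] at this
    omega
  rcases lt_trichotomy x 0 with hx | hx | hx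
  · obtain ⟨y, rfl⟩ : ∃ y : ℕ, x = -((y + 1 : ℕ) : ℤ) := ⟨(-x - 1).toNat, by omega⟩
    have hy : y + 1 ≤ k * p := by
      have : ((y + 1 : ℕ) : ℤ) ≤ (k * p : ℕ) := by push_cast at h1 ⊢; linarith
      exact_mod_cast this
    have hp : 0 < p := by
      rcases Nat.eq_zero_or_pos p with h | h
      · rw [h] at hy; omega
      · exact h
    have hlt := Nat.mod_lt y hp
    have hdm := Nat.div_add_mod y p
    have hi : y / p < k := (Nat.div_lt_iff_lt_mul hp).2 (by omega)
    refine ⟨y / p * (p + q) + (q + y % p) + 1, bound _ _ hi (by omega), ?_⟩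
    rw [tau_eval _ _ _ _ (by omega), if_neg (by omega)]
    rw [mul_comm] at hdm
    have : y / p * p + (q + y % p - q) + 1 = y + 1 := by omega
    rw [this]
  · exact ⟨0, Nat.zero_le _, by rw [hx]; simp [tau]⟩
  · obtain ⟨y, rfl⟩ : ∃ y : ℕ, x = ((y + 1 : ℕ) : ℤ) := ⟨(x - 1).toNat, by omega⟩
    have hy : y + 1 ≤ k * q := by exact_mod_cast h2
    have hq : 0 < q := by
      rcases Nat.eq_zero_or_pos q with h | h
      · rw [h] at hy; omega
      · exact h
    have hlt := Nat.mod_lt y hq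
    have hdm := Nat.div_add_mod y q
    have hi : y / q < k := (Nat.div_lt_iff_lt_mul hq).2 (by omega)
    refine ⟨y / q * (p + q) + y % q + 1, bound _ _ hi (by omega), ?_⟩
    rw [tau_eval _ _ _ _ (by omega), if_pos hlt]
    rw [mul_comm] at hdm
    rw [hdm]

lemma le_diamN {X : Finset ℤ} {a b : ℤ} (ha : a ∈ X) (hb : b ∈ X) :
    (a - b).natAbs ≤ diamN X :=
  Finset.le_sup (f := fun p : ℤ × ℤ => (p.1 - p.2).natAbs) (Finset.mk_mem_product ha hb)

end Reduction

theorem order_of_basis_minus_subset_le_of_mu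
    (A : Set ℤ) (h : ℕ) (hA : IsAdditiveBasis A) (hordA : basisOrder A = h)
    (X : Finset ℤ) (hXne : X.Nonempty) (hXA : ↑X ⊆ A)
    (hB : IsAdditiveBasis (A \ ↑X))
    (μ : ℕ)
    (hμ : μ = sInf {e : ℕ | ∃ y ∈ A \ ↑X, e = diamN (insert y X)}) :
    basisOrder (A \ ↑X) ≤ h * μ * (h * μ + 3) / 2 := by
  classical
  obtain ⟨-, m, hm1, hm⟩ := hB
  have hne : {e : ℕ | ∃ y ∈ A \ ↑X, e = diamN (insert y X)}.Nonempty := by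
    obtain ⟨N, hN⟩ := Filter.eventually_atTop.1 hm
    obtain ⟨f, hf, -⟩ := hN N le_rfl
    exact ⟨_, f ⟨0, hm1⟩, hf _, rfl⟩
  obtain ⟨y, hyB, hy⟩ := Nat.sInf_mem hne
  rw [← hμ] at hy
  have hh : 1 ≤ h ∧ RepBy A h := by
    have : basisOrder A ∈ {h : ℕ | 1 ≤ h ∧ RepBy A h} := Nat.sInf_mem hA.2
    rwa [hordA] at this
  obtain ⟨hh1, hrep⟩ := hh
  have hμ1 : 1 ≤ μ := by
    obtain ⟨x, hx⟩ := hXne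
    have h1 := le_diamN (Finset.mem_insert_of_mem hx : x ∈ insert y X) (Finset.mem_insert_self y X)
    have h2 : x ≠ y := by
      rintro rfl
      exact hyB.2 hx
    omega
  set Mx := (insert y X).max' (Finset.insert_nonempty y X) with hMx
  have hMmem : Mx ∈ insert y X := Finset.max'_mem _ _
  have hyle : y ≤ Mx := Finset.le_max' _ _ (Finset.mem_insert_self y X)
  obtain ⟨q, hq⟩ : ∃ q : ℕ, Mx = y + q := ⟨(Mx - y).toNat, by omega⟩
  have hqμ : q ≤ μ := by
    have := le_diamN hMmem (Finset.mem_insert_self y X)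
    omega
  obtain ⟨p, hp⟩ : ∃ p, μ = p + q := ⟨μ - q, by omega⟩
  have hXr : ∀ x ∈ X, -(p : ℤ) ≤ x - y ∧ x - y ≤ q := by
    intro x hx
    have hx' : x ∈ insert y X := Finset.mem_insert_of_mem hx
    have h1 := le_diamN hMmem hx'
    have h2 := Finset.le_max' _ _ hx'
    rw [← hMx] at h2
    omega
  set B := A \ (X : Set ℤ) with hBdef
  have h0 : (0 : ℤ) ∈ shiftSet B y := by
    show 0 + y ∈ B
    rw [zero_add]; exact hyB
  have key := core_bound h0 ((repBy_shiftSet B y m).2 hm) (h * μ) (fun j => tau p q (h * μ - j)) (by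
    filter_upwards [(repBy_shiftSet A y h).2 hrep] with N hN
    obtain ⟨f, hf, rfl⟩ := hN
    obtain ⟨k', k, hk, b, hb, t, ht1, ht2, hs⟩ := split_sum (B := shiftSet B y) p q h f (by
      intro i
      by_cases hi : f i + y ∈ X
      · right
        have := hXr _ hi
        simpa using this
      · left
        exact ⟨hf i, hi⟩)
    obtain ⟨s, hsk, hst⟩ := tau_surj p q k t ht1 ht2
    rw [← hp] at hsk
    have h1 : h * μ = k' * μ + k * μ := by rw [← hk]; ring
    have h2 : k' ≤ k' * μ := Nat.le_mul_of_pos_right _ hμ1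
    refine ⟨h * μ - s, by omega, ?_⟩
    have h3 : h * μ - (h * μ - s) = s := by omega
    rw [h3, hst, hs, add_sub_cancel_right]
    exact foldSum_mono h0 (by omega) hb)
  refine Nat.sInf_le ⟨?_, (repBy_shiftSet B y _).1 key⟩
  have h1 : 1 ≤ h * μ := Nat.mul_pos hh1 hμ1
  rw [Nat.le_div_iff_mul_le (by norm_num)]
  nlinarith
end
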